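/- arXiv:0808.3518 — 7 statements merged into one kernel-verified Lean document; each statement's English description precedes it below -/
import Mathlib

section
/- Let λ_1, …, λ_n be elements of Λ and suppose there exist strictly positive real numbers t_1, …, t_n such that t_1 λ_1 + ⋯ + t_n λ_n = 0 in V = ℝ ⊗_ℤ Λ. Then there exist strictly positive integers r_1, …, r_n such that r_1 λ_1 + ⋯ + r_n λ_n = 0 in Λ. -/
open scoped TensorProduct

variable (Λ : Type) [AddCommGroup Λ]

/-- The real vector space `V = ℝ ⊗_ℤ Λ` spanned by the lattice `Λ`. -/
abbrev RV : Type := ℝ ⊗[ℤ] Λ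

/-- The canonical map `Λ → ℝ ⊗_ℤ Λ`, `λ ↦ 1 ⊗ λ`. -/
noncomputable def iota : Λ →ₗ[ℤ] RV Λ := TensorProduct.mk ℤ ℝ Λ 1

theorem exists_pos_functional (n : ℕ) (t : Fin n → ℝ) (ht : ∀ i, 0 < t i) :
    ∃ f : ℝ →ₗ[ℚ] ℚ, ∀ i, 0 < f (t i) := by
  classical
  let W : Submodule ℚ ℝ := Submodule.span ℚ (Set.range t)
  have : FiniteDimensional ℚ W := FiniteDimensional.span_of_finite ℚ (Set.finite_range t)
  let b := Module.finBasis ℚ W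
  let w : Fin n → W := fun i => ⟨t i, Submodule.subset_span ⟨i, rfl⟩⟩
  let U : Set (Fin (Module.finrank ℚ W) → ℝ) :=
    {s | ∀ i, 0 < ∑ j, ((b.repr (w i) j : ℚ) : ℝ) * s j}
  have hU : IsOpen U := by
    have : U = ⋂ i, {s | 0 < ∑ j, ((b.repr (w i) j : ℚ) : ℝ) * s j} := by
      ext s; simp [U]
    rw [this]
    exact isOpen_iInter_of_finite fun i => isOpen_lt continuous_const (by fun_prop)
  have hne : U.Nonempty := by
    refine ⟨fun j => (b j : ℝ), fun i => ?_⟩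
    have h1 := congrArg (Subtype.val) (b.sum_repr (w i))
    have h2 : ∑ j, ((b.repr (w i) j : ℚ) : ℝ) * (b j : ℝ) = t i := by
      refine Eq.trans ?_ h1
      simp only [AddSubmonoidClass.coe_finsetSum, Submodule.coe_smul, Rat.smul_def]
    rw [h2]; exact ht i
  have hd : DenseRange (Pi.map (fun (_ : Fin (Module.finrank ℚ W)) (q : ℚ) => (q : ℝ))) :=
    DenseRange.piMap fun _ => Rat.denseRange_cast
  obtain ⟨s, hs⟩ := hd.exists_mem_open hU hne
  obtain ⟨f, hf⟩ := LinearMap.exists_extend (b.constr ℚ s)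
  refine ⟨f, fun i => ?_⟩
  have h3 : f (t i) = b.constr ℚ s (w i) := by rw [← hf]; rfl
  rw [h3, Module.Basis.constr_apply_fintype]
  have := hs i
  simp only [Pi.map_apply] at this
  simp only [smul_eq_mul, Module.Basis.equivFun_apply]
  exact_mod_cast this

theorem statement3 [Module.Free ℤ Λ] [Module.Finite ℤ Λ] (n : ℕ) (l : Fin n → Λ) (t : Fin n → ℝ)
    (ht : ∀ i, 0 < t i) (h : ∑ i, t i • iota Λ (l i) = 0) :
    ∃ r : Fin n → ℤ, (∀ i, 0 < r i) ∧ ∑ i, r i • l i = 0 := by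
  classical
  obtain ⟨f, hf⟩ := exists_pos_functional n t ht
  have key : ∀ c : Λ →ₗ[ℤ] ℤ, ∑ i, (c (l i) : ℚ) * f (t i) = 0 := by
    intro c
    have hi : ∀ (a : ℝ) (x : Λ), a • iota Λ x = a ⊗ₜ[ℤ] x := by
      intro a x
      change a • ((1 : ℝ) ⊗ₜ[ℤ] x) = _
      rw [TensorProduct.smul_tmul', smul_eq_mul, mul_one]
    simp only [hi] at h
    have h1 := congrArg (fun x => f (TensorProduct.rid ℤ ℝ (LinearMap.lTensor ℝ c x))) h
    have h2 : ∀ (m : ℤ) (a : ℝ), f ((m : ℝ) * a) = (m : ℚ) * f a := by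
      intro m a
      rw [← zsmul_eq_mul, map_zsmul, zsmul_eq_mul]
    simpa [map_sum, h2] using h1
  let N : ℕ := ∏ i, (f (t i)).den
  have hN : 0 < N := Finset.prod_pos fun i _ => (f (t i)).den_pos
  have hr : ∀ i, ∃ r : ℤ, (r : ℚ) = N * f (t i) := by
    intro i
    obtain ⟨k, hk⟩ : (f (t i)).den ∣ N := Finset.dvd_prod_of_mem _ (Finset.mem_univ i)
    refine ⟨k * (f (t i)).num, ?_⟩
    rw [hk]
    push_cast
    rw [← Rat.mul_den_eq_num (f (t i))]
    ring
  choose r hr using hr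
  refine ⟨r, fun i => ?_, ?_⟩
  · have : (0 : ℚ) < r i := by
      rw [hr]; exact mul_pos (by exact_mod_cast hN) (hf i)
    exact_mod_cast this
  · let b := Module.Free.chooseBasis ℤ Λ
    refine b.ext_elem fun j => ?_
    have h2 := key (b.coord j)
    have h3 : ∑ i, (r i : ℚ) * (b.coord j (l i) : ℚ) = 0 := by
      have : ∑ i, (r i : ℚ) * (b.coord j (l i) : ℚ)
          = N * ∑ i, (b.coord j (l i) : ℚ) * f (t i) := by
        rw [Finset.mul_sum]
        refine Finset.sum_congr rfl fun i _ => ?_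
        rw [hr]; ring
      rw [this, h2, mul_zero]
    have h4 : ∑ i, r i * b.coord j (l i) = 0 := by exact_mod_cast h3
    have h5 : b.coord j (∑ i, r i • l i) = 0 := by
      rw [map_sum, ← h4]
      simp
    simpa using h5
end

section
/- Let φ be a nonzero linear form on V. Then the map i_φ̄ : Pos(Ker φ|_Λ) → Pos(Λ) given by i_φ̄(X) = X ∪ Pos⁺(φ) is well defined (its values are positive parts of Λ), its image is exactly π^{-1}(φ̄) = {Y ∈ Pos(Λ) | π(Y) = φ̄}, it is injective, and its inverse on π^{-1}(φ̄) is the map Y ↦ Y ∩ Ker φ|_Λ. -/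
open scoped TensorProduct

variable (Λ : Type) [AddCommGroup Λ]

/-- A subset `X` of a lattice `Λ` is a *positive part* if `Λ = X ∪ (-X)`,
`X + X ⊆ X`, and `X ∩ (-X)` is a subgroup of `Λ`. -/
def IsPositivePart (X : Set Λ) : Prop :=
  X ∪ (-X) = Set.univ ∧ (∀ a ∈ X, ∀ b ∈ X, a + b ∈ X) ∧
    ∃ H : AddSubgroup Λ, (H : Set Λ) = X ∩ (-X)

/-- `Pos(Λ)`, the set of positive parts of `Λ`. -/
def PosParts : Type := {X : Set Λ // IsPositivePart Λ X}

/-- `U(E) = {X ∈ Pos(Λ) | X ∩ E = ∅}`. -/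
def UU (E : Set Λ) : Set (PosParts Λ) := {X | X.val ∩ E = ∅}

/-- The topology on `Pos(Λ)`: a subset `U` is open iff for every `X ∈ U` there is a
finite set `E ⊆ Λ` with `X ∈ U(E)` and `U(E) ⊆ U`. -/
instance posTop : TopologicalSpace (PosParts Λ) where
  IsOpen U := ∀ X ∈ U, ∃ E : Finset Λ, X ∈ UU Λ (E : Set Λ) ∧ UU Λ (E : Set Λ) ⊆ U
  isOpen_univ := by
    intro X _
    exact ⟨∅, by simp [UU], fun _ _ => trivial⟩
  isOpen_inter := by
    rintro s t hs ht X ⟨hXs, hXt⟩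
    obtain ⟨E1, h1, h1'⟩ := hs X hXs
    obtain ⟨E2, h2, h2'⟩ := ht X hXt
    letI := Classical.decEq Λ
    refine ⟨E1 ∪ E2, ?_, ?_⟩
    · simp only [UU, Set.mem_setOf_eq, Finset.coe_union, Set.inter_union_distrib_left] at *
      rw [h1, h2, Set.union_empty]
    · intro Y hY
      simp only [UU, Set.mem_setOf_eq, Finset.coe_union, Set.inter_union_distrib_left,
        Set.union_empty_iff] at hY
      exact ⟨h1' hY.1, h2' hY.2⟩
  isOpen_sUnion := by
    intro S hS X hX
    obtain ⟨s, hs, hXs⟩ := hX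
    obtain ⟨E, hE, hE'⟩ := hS s hs X hXs
    exact ⟨E, hE, fun Y hY => ⟨s, hs, hE' hY⟩⟩

/-- `Pos(φ) = {λ ∈ Λ | φ(λ) ≥ 0}` for a linear form `φ` on `V = ℝ ⊗_ℤ Λ`. -/
def PosSet (φ : Module.Dual ℝ (RV Λ)) : Set Λ := {l | 0 ≤ φ (iota Λ l)}

/-- `Pos⁺(φ) = {λ ∈ Λ | φ(λ) > 0}` for a linear form `φ` on `V = ℝ ⊗_ℤ Λ`. -/
def PosPlus (φ : Module.Dual ℝ (RV Λ)) : Set Λ := {l | 0 < φ (iota Λ l)}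

/-- The weak topology on the dual space `V*` (`V` being finite dimensional, this is
its standard topology). -/
noncomputable instance dualTop : TopologicalSpace (Module.Dual ℝ (RV Λ)) :=
  ⨅ v : RV Λ, TopologicalSpace.induced (fun φ => φ v) inferInstance

/-- Two linear forms on `V` are equivalent iff they differ by a strictly positive scalar. -/
def dualSetoid : Setoid (Module.Dual ℝ (RV Λ)) where
  r φ ψ := ∃ κ : ℝ, 0 < κ ∧ ψ = κ • φ
  iseqv := by
    constructor
    · exact fun φ => ⟨1, one_pos, (one_smul ℝ φ).symm⟩
    · rintro φ ψ ⟨κ, hκ, rfl⟩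
      exact ⟨κ⁻¹, inv_pos.2 hκ, by rw [smul_smul, inv_mul_cancel₀ hκ.ne', one_smul]⟩
    · rintro φ ψ χ ⟨κ, hκ, rfl⟩ ⟨κ', hκ', rfl⟩
      exact ⟨κ' * κ, mul_pos hκ' hκ, smul_smul κ' κ φ⟩

/-- `V*/ℝ_{>0}`, the quotient of the dual space by positive rescaling, endowed with
the quotient topology. -/
abbrev DualQuot : Type := Quotient (dualSetoid Λ)

/-- Characterization of the map `π : Pos(Λ) → V*/ℝ_{>0}` from the Hahn–Banach theorem
for positive parts: `π X` is the unique class `φ̄` with `X ⊆ Pos(φ)` (represented by a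
nonzero form when `X ≠ Λ`, and `π(Λ) = 0̄`). -/
def IsPi (π : PosParts Λ → DualQuot Λ) : Prop :=
  ∀ X : PosParts Λ, ∃ φ : Module.Dual ℝ (RV Λ),
    π X = Quotient.mk (dualSetoid Λ) φ ∧ X.val ⊆ PosSet Λ φ ∧ (X.val ≠ Set.univ → φ ≠ 0)

/-- The lattice `Ker φ|_Λ = Λ ∩ Ker φ`. -/
noncomputable def kerLat (φ : Module.Dual ℝ (RV Λ)) : AddSubgroup Λ :=
  AddMonoidHom.ker ((φ.toAddMonoidHom).comp (iota Λ).toAddMonoidHom)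

/-- The underlying subset of `Λ` of `i_φ̄(X) = X ∪ Pos⁺(φ)`, for `X ⊆ Ker φ|_Λ`. -/
noncomputable def iSet (φ : Module.Dual ℝ (RV Λ)) (S : Set (kerLat Λ φ)) : Set Λ :=
  (Subtype.val '' S) ∪ PosPlus Λ φ

theorem aux_iota_neg (φ : Module.Dual ℝ (RV Λ)) (l : Λ) :
    φ (iota Λ (-l)) = - φ (iota Λ l) := by rw [map_neg, map_neg]

theorem aux_iota_add (φ : Module.Dual ℝ (RV Λ)) (l m : Λ) :
    φ (iota Λ (l + m)) = φ (iota Λ l) + φ (iota Λ m) := by rw [map_add, map_add]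

theorem aux_mem_ker (φ : Module.Dual ℝ (RV Λ)) (l : Λ) :
    l ∈ kerLat Λ φ ↔ φ (iota Λ l) = 0 := Iff.rfl

theorem aux_ext (φ ψ : Module.Dual ℝ (RV Λ)) (h : ∀ l, φ (iota Λ l) = ψ (iota Λ l)) :
    φ = ψ := by
  apply LinearMap.ext
  intro v
  induction v using TensorProduct.induction_on with
  | zero => simp
  | add x y hx hy => rw [map_add, map_add, hx, hy]
  | tmul r l =>
    have e : (r ⊗ₜ[ℤ] l : RV Λ) = r • iota Λ l := by
      change r ⊗ₜ[ℤ] l = r • ((1 : ℝ) ⊗ₜ[ℤ] l)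
      rw [TensorProduct.smul_tmul', smul_eq_mul, mul_one]
    rw [e, map_smul, map_smul, h]

theorem aux_real (f g : Λ →+ ℝ) (h : ∀ l, 0 < f l → 0 ≤ g l) (a : Λ) (ha : 0 < f a) (b : Λ) :
    g b ≤ f b / f a * g a := by
  have hga := h a ha
  have key : ∀ q : ℚ, f b / f a < q → g b ≤ q * g a := by
    intro q hq
    have hd : (0 : ℝ) < q.den := by exact_mod_cast q.den_pos
    have hqe : (q : ℝ) = q.num / q.den := by exact_mod_cast (Rat.num_div_den q).symm
    have h1 := h (q.num • a - q.den • b) (by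
      rw [map_sub, map_zsmul, map_nsmul, zsmul_eq_mul, nsmul_eq_mul]
      rw [hqe, div_lt_div_iff₀ ha hd] at hq
      linarith)
    rw [map_sub, map_zsmul, map_nsmul, zsmul_eq_mul, nsmul_eq_mul] at h1
    rw [hqe, div_mul_eq_mul_div, le_div_iff₀ hd]
    linarith
  by_contra! hc
  rcases hga.eq_or_lt with h0 | h0
  · obtain ⟨q, hq⟩ := exists_rat_gt (f b / f a)
    have := key q hq
    rw [← h0] at this hc
    linarith
  · obtain ⟨q, hq, hq'⟩ := exists_rat_btwn ((lt_div_iff₀ h0).2 hc)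
    have := key q hq
    rw [lt_div_iff₀ h0] at hq'
    linarith

theorem aux_unique (φ ψ : Module.Dual ℝ (RV Λ)) (hφ : φ ≠ 0) (hψ : ψ ≠ 0)
    (h : ∀ l, 0 < φ (iota Λ l) → 0 ≤ ψ (iota Λ l)) : ∃ κ : ℝ, 0 < κ ∧ ψ = κ • φ := by
  obtain ⟨a, ha⟩ : ∃ a, 0 < φ (iota Λ a) := by
    by_contra! hc
    apply hφ
    apply aux_ext
    intro l
    have h1 := hc l
    have h2 := hc (-l)
    rw [aux_iota_neg] at h2
    rw [LinearMap.zero_apply]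
    linarith
  have hle := aux_real Λ ((φ.toAddMonoidHom).comp (iota Λ).toAddMonoidHom)
    ((ψ.toAddMonoidHom).comp (iota Λ).toAddMonoidHom) h a ha
  change ∀ b, ψ (iota Λ b) ≤ φ (iota Λ b) / φ (iota Λ a) * ψ (iota Λ a) at hle
  have heq : ψ = (ψ (iota Λ a) / φ (iota Λ a)) • φ := by
    apply aux_ext
    intro l
    have h1 := hle l
    have h2 := hle (-l)
    rw [aux_iota_neg, aux_iota_neg, neg_div, neg_mul] at h2
    rw [LinearMap.smul_apply, smul_eq_mul]
    have : ψ (iota Λ a) / φ (iota Λ a) * φ (iota Λ l)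
      = φ (iota Λ l) / φ (iota Λ a) * ψ (iota Λ a) := by ring
    rw [this]
    linarith
  refine ⟨_, lt_of_le_of_ne (div_nonneg (h a ha) ha.le) ?_, heq⟩
  intro h0
  rw [← h0, zero_smul] at heq
  exact hψ heq

theorem aux_mem (φ : Module.Dual ℝ (RV Λ)) (S : Set (kerLat Λ φ)) (l : Λ) :
    l ∈ iSet Λ φ S ↔ (∃ h : l ∈ kerLat Λ φ, (⟨l, h⟩ : kerLat Λ φ) ∈ S) ∨ 0 < φ (iota Λ l) := by
  simp [iSet, PosPlus]

theorem aux_mem0 (φ : Module.Dual ℝ (RV Λ)) (S : Set (kerLat Λ φ)) (l : kerLat Λ φ) :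
    (l : Λ) ∈ iSet Λ φ S ↔ l ∈ S := by
  rw [aux_mem]
  have := (aux_mem_ker Λ φ l).1 l.2
  simp [this]

theorem aux_nonneg (φ : Module.Dual ℝ (RV Λ)) (S : Set (kerLat Λ φ)) (l : Λ)
    (hl : l ∈ iSet Λ φ S) : 0 ≤ φ (iota Λ l) := by
  rcases (aux_mem Λ φ S l).1 hl with ⟨h, -⟩ | h
  · exact ((aux_mem_ker Λ φ l).1 h).ge
  · exact h.le

theorem aux_total {M : Type} [AddCommGroup M] {X : Set M} (h : IsPositivePart M X) (l : M) :
    l ∈ X ∨ -l ∈ X := by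
  have : l ∈ X ∪ -X := by rw [h.1]; trivial
  simpa using this

/-- Criterion: the third axiom follows from the first two. -/
theorem aux_mk {M : Type} [AddCommGroup M] {X : Set M} (h1 : ∀ l, l ∈ X ∨ -l ∈ X)
    (h2 : ∀ a ∈ X, ∀ b ∈ X, a + b ∈ X) : IsPositivePart M X := by
  have h0 : (0 : M) ∈ X := by simpa using h1 0
  refine ⟨?_, h2, ⟨⟨⟨X ∩ -X, ?_⟩, ?_⟩, ?_⟩, rfl⟩
  · ext l
    simpa using h1 l
  · rintro a b ⟨ha, ha'⟩ ⟨hb, hb'⟩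
    refine ⟨h2 a ha b hb, ?_⟩
    rw [Set.mem_neg] at *
    rw [neg_add]
    exact h2 _ ha' _ hb'
  · exact ⟨h0, by simpa using h0⟩
  · rintro a ⟨ha, ha'⟩
    exact ⟨ha', by simpa using ha⟩

theorem aux_iSet_pos (φ : Module.Dual ℝ (RV Λ)) (X : PosParts (kerLat Λ φ)) :
    IsPositivePart Λ (iSet Λ φ X.val) := by
  apply aux_mk
  · intro l
    rcases lt_trichotomy (φ (iota Λ l)) 0 with h | h | h
    · right
      rw [aux_mem, aux_iota_neg]
      right
      linarith
    · rcases aux_total X.2 ⟨l, h⟩ with h' | h'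
      · exact Or.inl ((aux_mem0 Λ φ _ ⟨l, h⟩).2 h')
      · exact Or.inr ((aux_mem0 Λ φ _ (-⟨l, h⟩)).2 h')
    · left
      rw [aux_mem]
      exact Or.inr h
  · intro a ha b hb
    have na := aux_nonneg Λ φ _ a ha
    have nb := aux_nonneg Λ φ _ b hb
    rw [aux_mem] at ha hb
    rcases ha with ⟨ha, ha'⟩ | ha
    · rcases hb with ⟨hb, hb'⟩ | hb
      · exact (aux_mem0 Λ φ _ (⟨a, ha⟩ + ⟨b, hb⟩)).2 (X.2.2.1 _ ha' _ hb')
      · rw [aux_mem, aux_iota_add]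
        right
        linarith
    · rw [aux_mem, aux_iota_add]
      right
      linarith

theorem aux_restrict (φ : Module.Dual ℝ (RV Λ)) (Y : PosParts Λ) :
    IsPositivePart ↥(kerLat Λ φ) {x : ↥(kerLat Λ φ) | (x : Λ) ∈ Y.val} :=
  aux_mk (fun l => aux_total Y.2 (l : Λ)) (fun a ha b hb => Y.2.2.1 _ ha _ hb)

theorem aux_inv (φ : Module.Dual ℝ (RV Λ)) (Y : PosParts Λ) (hY : Y.val ⊆ PosSet Λ φ) :
    iSet Λ φ {x : ↥(kerLat Λ φ) | (x : Λ) ∈ Y.val} = Y.val := by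
  ext l
  rw [aux_mem]
  constructor
  · rintro (⟨h, h'⟩ | h)
    · exact h'
    · rcases aux_total Y.2 l with h' | h'
      · exact h'
      · have h3 : 0 ≤ φ (iota Λ (-l)) := hY h'
        rw [aux_iota_neg] at h3
        linarith
  · intro h
    have h3 : 0 ≤ φ (iota Λ l) := hY h
    rcases h3.eq_or_lt with h4 | h4
    · exact Or.inl ⟨h4.symm, h⟩
    · exact Or.inr h4

theorem aux_sub (φ : Module.Dual ℝ (RV Λ)) (π : PosParts Λ → DualQuot Λ) (hπ : IsPi Λ π)
    (Y : PosParts Λ) (hY : π Y = Quotient.mk (dualSetoid Λ) φ) : Y.val ⊆ PosSet Λ φ := by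
  obtain ⟨ψ, h1, h2, -⟩ := hπ Y
  obtain ⟨κ, hκ, rfl⟩ : ∃ κ : ℝ, 0 < κ ∧ φ = κ • ψ := Quotient.exact (h1.symm.trans hY)
  intro l hl
  exact mul_nonneg hκ.le (h2 hl)

theorem statement6 [Module.Free ℤ Λ] [Module.Finite ℤ Λ] (φ : Module.Dual ℝ (RV Λ)) (hφ : φ ≠ 0)
    (π : PosParts Λ → DualQuot Λ) (hπ : IsPi Λ π) :
    (∀ X : PosParts ↥(kerLat Λ φ), IsPositivePart Λ (iSet Λ φ X.val)) ∧
    (∀ X X' : PosParts ↥(kerLat Λ φ), iSet Λ φ X.val = iSet Λ φ X'.val → X = X') ∧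
    ({Y : PosParts Λ | π Y = Quotient.mk (dualSetoid Λ) φ}
      = {Y : PosParts Λ | ∃ X : PosParts ↥(kerLat Λ φ), Y.val = iSet Λ φ X.val}) ∧
    (∀ Y : PosParts Λ, π Y = Quotient.mk (dualSetoid Λ) φ →
      IsPositivePart ↥(kerLat Λ φ) {x : ↥(kerLat Λ φ) | (x : Λ) ∈ Y.val}) ∧
    (∀ Y : PosParts Λ, π Y = Quotient.mk (dualSetoid Λ) φ →
      iSet Λ φ {x : ↥(kerLat Λ φ) | (x : Λ) ∈ Y.val} = Y.val) := by
  refine ⟨aux_iSet_pos Λ φ, ?_, ?_, fun Y _ => aux_restrict Λ φ Y,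
    fun Y hY => aux_inv Λ φ Y (aux_sub Λ φ π hπ Y hY)⟩
  · intro X X' h
    apply Subtype.ext
    ext l
    rw [← aux_mem0 Λ φ X.val, h, aux_mem0]
  · ext Y
    constructor
    · intro hY
      exact ⟨⟨_, aux_restrict Λ φ Y⟩, (aux_inv Λ φ Y (aux_sub Λ φ π hπ Y hY)).symm⟩
    · rintro ⟨X, hX⟩
      obtain ⟨ψ, h1, h2, h3⟩ := hπ Y
      have hne : Y.val ≠ Set.univ := by
        intro hu
        apply hφ
        apply aux_ext
        intro l
        have e : ∀ m, 0 ≤ φ (iota Λ m) := fun m =>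
          aux_nonneg Λ φ X.val m (by rw [← hX, hu]; trivial)
        have e1 := e l
        have e2 := e (-l)
        rw [aux_iota_neg] at e2
        rw [LinearMap.zero_apply]
        linarith
      have hu := aux_unique Λ φ ψ hφ (h3 hne) (fun l hl => h2 (by
        rw [hX, aux_mem]
        exact Or.inr hl))
      change π Y = _
      rw [h1]
      exact (Quotient.sound (s := dualSetoid Λ) hu).symm
end

section
/- Let E be a finite subset of Λ. Then the following are equivalent: (1) U(E) = ∅; (2) there exist n ≥ 1, elements λ_1, …, λ_n ∈ E and strictly positive integers r_1, …, r_n such that r_1 λ_1 + ⋯ + r_n λ_n = 0; (3) there is no linear form φ on V = ℝ ⊗_ℤ Λ with φ(λ) > 0 for all λ ∈ E. -/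
open scoped TensorProduct

variable (Λ : Type) [AddCommGroup Λ]

theorem gordan_aux [Module.Free ℤ Λ] (n : ℕ) : ∀ v : Fin n → Λ,
    (∃ f : Λ →ₗ[ℤ] ℤ, ∀ i, 0 < f (v i)) ∨
    (∃ c : Fin n → ℤ, (∀ i, 0 ≤ c i) ∧ (∃ i, 0 < c i) ∧ ∑ i, c i • v i = 0) := by
  induction n with
  | zero => exact fun v => Or.inl ⟨0, fun i => i.elim0⟩
  | succ n ih =>
    intro v
    by_cases ha0 : v 0 = 0
    · right
      refine ⟨Pi.single 0 1, fun i => ?_, ⟨0, by simp⟩, ?_⟩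
      · by_cases h : i = 0
        · subst h; simp
        · simp [h]
      · rw [Fin.sum_univ_succ]; simp [ha0]
    rcases ih (fun i => v i.succ) with ⟨f, hf⟩ | ⟨c, hc, ⟨j, hj⟩, hs⟩
    swap
    · right
      refine ⟨Fin.cons 0 c, fun i => ?_, ⟨j.succ, by simpa using hj⟩, ?_⟩
      · refine Fin.cases ?_ ?_ i
        · simp
        · simpa using hc
      · rw [Fin.sum_univ_succ]; simpa using hs
    -- combining two forms
    have comb : ∀ (g : Λ →ₗ[ℤ] ℤ) (t : ℚ), 0 < (g (v 0) : ℚ) + t * f (v 0) →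
        (∀ i : Fin n, 0 < (g (v i.succ) : ℚ) + t * f (v i.succ)) →
        ∃ h : Λ →ₗ[ℤ] ℤ, ∀ i, 0 < h (v i) := by
      intro g t h0 h1
      have key : ∀ x, 0 < (g x : ℚ) + t * f x → 0 < ((t.den : ℤ) • g + t.num • f) x := by
        intro x hx
        have hd : (0 : ℚ) < t.den := by exact_mod_cast t.den_pos
        have e : (t.den : ℚ) * t = t.num := by
          rw [mul_comm]; exact Rat.mul_den_eq_num t
        have := mul_pos hd hx
        rw [mul_add, ← mul_assoc, e] at this
        simp only [LinearMap.add_apply, LinearMap.smul_apply, smul_eq_mul]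
        exact_mod_cast this
      refine ⟨(t.den : ℤ) • g + t.num • f, fun i => ?_⟩
      · refine Fin.cases ?_ ?_ i
        · exact key _ h0
        · exact fun i => key _ (h1 i)
    have hfq : ∀ i : Fin n, (0 : ℚ) < f (v i.succ) := fun i => by exact_mod_cast hf i
    rcases lt_trichotomy (f (v 0)) 0 with hneg | hz | hpos
    · rcases ih (fun i => f (v i.succ) • v 0 + (- f (v 0)) • v i.succ) with
        ⟨g, hg⟩ | ⟨c, hc, ⟨j, hj⟩, hs⟩
      · left
        have hA : (0 : ℚ) < - f (v 0) := by
          have : (f (v 0) : ℚ) < 0 := by exact_mod_cast hneg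
          linarith
        obtain ⟨t, ht1, ht2⟩ := Order.exists_between_finsets
          (lo := Finset.univ.image fun i : Fin n => -(g (v i.succ) : ℚ) / f (v i.succ))
          (hi := {(g (v 0) : ℚ) / (- f (v 0))}) (by
            intro x hx y hy
            simp only [Finset.mem_image, Finset.mem_univ, true_and, Finset.mem_singleton] at hx hy
            obtain ⟨i, rfl⟩ := hx
            subst hy
            rw [div_lt_div_iff₀ (hfq i) hA]
            have := hg i
            simp only [map_add, map_smul, smul_eq_mul] at this
            have h2 : (0 : ℚ) < f (v i.succ) * g (v 0) + -f (v 0) * g (v i.succ) := by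
              exact_mod_cast this
            linarith)
        refine comb g t ?_ fun i => ?_
        · have := ht2 _ (Finset.mem_singleton_self _)
          rw [lt_div_iff₀ hA] at this
          linarith
        · have := ht1 _ (Finset.mem_image_of_mem _ (Finset.mem_univ i))
          rw [div_lt_iff₀ (hfq i)] at this
          linarith
      · right
        refine ⟨Fin.cons (∑ i, c i * f (v i.succ)) (fun i => c i * (- f (v 0))), fun i => ?_,
          ⟨j.succ, ?_⟩, ?_⟩
        · refine Fin.cases ?_ (fun i => ?_) i
          · simp only [Fin.cons_zero]
            exact Finset.sum_nonneg fun i _ => mul_nonneg (hc i) (hf i).le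
          · simp only [Fin.cons_succ]
            exact mul_nonneg (hc i) (by linarith)
        · simp only [Fin.cons_succ]
          exact mul_pos hj (by linarith)
        · rw [Fin.sum_univ_succ]
          simp only [Fin.cons_zero, Fin.cons_succ]
          rw [← hs, Finset.sum_smul, ← Finset.sum_add_distrib]
          refine Finset.sum_congr rfl fun i _ => ?_
          rw [smul_add, smul_smul, smul_smul]
    · left
      have : ∃ g : Λ →ₗ[ℤ] ℤ, 0 < g (v 0) := by
        let b := Module.Free.chooseBasis ℤ Λ
        have : ∃ i, b.coord i (v 0) ≠ 0 := by
          by_contra! h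
          exact ha0 (b.forall_coord_eq_zero_iff.mp h)
        obtain ⟨i, hi⟩ := this
        rcases lt_or_gt_of_ne hi with h | h
        · exact ⟨- b.coord i, by simpa using h⟩
        · exact ⟨b.coord i, h⟩
      obtain ⟨g, hg⟩ := this
      obtain ⟨t, ht1, -⟩ := Order.exists_between_finsets
          (lo := Finset.univ.image fun i : Fin n => -(g (v i.succ) : ℚ) / f (v i.succ))
          (hi := ∅) (by simp)
      refine comb g t ?_ fun i => ?_
      · rw [hz]; simpa using hg
      · have := ht1 _ (Finset.mem_image_of_mem _ (Finset.mem_univ i))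
        rw [div_lt_iff₀ (hfq i)] at this
        linarith
    · exact Or.inl ⟨f, fun i => Fin.cases hpos hf i⟩

theorem statement9 [Module.Free ℤ Λ] [Module.Finite ℤ Λ] (E : Finset Λ) :
    List.TFAE [UU Λ (E : Set Λ) = ∅,
      ∃ n : ℕ, 1 ≤ n ∧ ∃ l : Fin n → Λ, (∀ i, l i ∈ E) ∧
        ∃ r : Fin n → ℤ, (∀ i, 0 < r i) ∧ ∑ i, r i • l i = 0,
      ¬ ∃ φ : Module.Dual ℝ (RV Λ), ∀ l ∈ E, 0 < φ (iota Λ l)] := by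
  tfae_have 1 → 3 := by
    rintro h ⟨φ, hφ⟩
    let X : Set Λ := {x | φ (iota Λ x) ≤ 0}
    have hX : IsPositivePart Λ X := by
      refine ⟨?_, ?_, ((φ.restrictScalars ℤ) ∘ₗ iota Λ).ker.toAddSubgroup, ?_⟩
      · ext x
        simp only [X, Set.mem_union, Set.mem_neg, Set.mem_setOf_eq, map_neg, Set.mem_univ, iff_true]
        rcases le_total (φ (iota Λ x)) 0 with h | h
        · exact Or.inl h
        · right; linarith
      · intro a ha b hb
        simp only [X, Set.mem_setOf_eq, map_add] at *
        linarith
      · ext x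
        simp only [X, Set.mem_inter_iff, Set.mem_neg, Set.mem_setOf_eq, map_neg, SetLike.mem_coe,
          Submodule.mem_toAddSubgroup, LinearMap.mem_ker, LinearMap.comp_apply,
          LinearMap.restrictScalars_apply]
        constructor
        · intro h; constructor <;> linarith
        · rintro ⟨h1, h2⟩; linarith
    have : (⟨X, hX⟩ : PosParts Λ) ∈ UU Λ (E : Set Λ) := by
      change X ∩ (E : Set Λ) = ∅
      ext x
      simp only [X, Set.mem_inter_iff, Set.mem_setOf_eq, Set.mem_empty_iff_false, iff_false, not_and]
      intro h1 h2
      have := hφ x h2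
      linarith
    rw [h] at this
    exact this
  tfae_have 3 → 2 := by
    intro h
    rcases gordan_aux Λ E.card (fun i => (E.equivFin.symm i : Λ)) with ⟨f, hf⟩ | ⟨c, hc, ⟨j, hj⟩, hs⟩
    · exfalso
      apply h
      refine ⟨LinearMap.liftBaseChange ℝ (Algebra.linearMap ℤ ℝ ∘ₗ f), fun l hl => ?_⟩
      have := hf (E.equivFin ⟨l, hl⟩)
      simp only [Equiv.symm_apply_apply] at this
      change (0 : ℝ) < LinearMap.liftBaseChange ℝ (Algebra.linearMap ℤ ℝ ∘ₗ f) ((1 : ℝ) ⊗ₜ[ℤ] l)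
      rw [LinearMap.liftBaseChange_tmul]
      simpa using this
    · let S := Finset.univ.filter fun i => 0 < c i
      have hjS : j ∈ S := by simp [S, hj]
      refine ⟨S.card, Finset.card_pos.mpr ⟨j, hjS⟩,
        fun k => (E.equivFin.symm (S.equivFin.symm k) : Λ), fun k => (E.equivFin.symm _).2,
        fun k => c (S.equivFin.symm k), fun k => ?_, ?_⟩
      · exact (Finset.mem_filter.mp (S.equivFin.symm k).2).2
      · rw [Equiv.sum_comp S.equivFin.symm
          (fun i : S => c i • (E.equivFin.symm (i : Fin E.card) : Λ)),
          Finset.sum_coe_sort S (fun i => c i • (E.equivFin.symm i : Λ)), ← hs]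
        refine Finset.sum_subset (Finset.subset_univ _) fun i _ hi => ?_
        have : c i = 0 := le_antisymm (by simpa [S] using hi) (hc i)
        simp [this]
  tfae_have 2 → 1 := by
    rintro ⟨n, hn, l, hl, r, hr, hs⟩
    refine Set.eq_empty_iff_forall_notMem.mpr ?_
    rintro ⟨X, hX1, hX2, _⟩ hE
    change X ∩ (E : Set Λ) = ∅ at hE
    have hor : ∀ x, x ∈ X ∨ -x ∈ X := fun x => by
      have : x ∈ X ∪ -X := hX1 ▸ Set.mem_univ x
      simpa using this
    have h0 : (0 : Λ) ∈ X := by simpa using hor 0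
    let M : AddSubmonoid Λ := ⟨⟨X, fun {a b} ha hb => hX2 a ha b hb⟩, h0⟩
    have hnot : ∀ i, l i ∉ X := fun i hi => by
      have : l i ∈ X ∩ (E : Set Λ) := ⟨hi, hl i⟩
      rw [hE] at this
      exact this
    have hneg : ∀ i, -l i ∈ M := fun i => (hor (l i)).resolve_left (hnot i)
    have hz : ∀ (m : ℤ) i, 0 ≤ m → m • (-l i) ∈ M := by
      intro m i hm
      lift m to ℕ using hm
      rw [natCast_zsmul]
      exact M.nsmul_mem (hneg i) m
    let i0 : Fin n := ⟨0, hn⟩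
    apply hnot i0
    change l i0 ∈ M
    have e : l i0 = (r i0 - 1) • (-l i0) + ∑ i ∈ Finset.univ.erase i0, r i • (-l i) := by
      have h1 := Finset.add_sum_erase Finset.univ (fun i => r i • (-l i)) (Finset.mem_univ i0)
      have h2 : ∑ i, r i • (-l i) = 0 := by simp [hs]
      rw [h2] at h1
      rw [sub_smul, one_smul, sub_neg_eq_add, add_right_comm, h1, zero_add]
    rw [e]
    exact M.add_mem (hz _ _ (by have := hr i0; omega))
      (M.sum_mem fun i _ => hz _ _ (hr i).le)
  tfae_finish
end

section
/- Let E be a finite subset of Λ such that U(E) ≠ ∅. Then the closure of U(E) in Pos(Λ) equals Pos(Λ) \ (⋃_{λ ∈ E} U(−λ)), where U(−λ) denotes U({−λ}). -/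
open scoped TensorProduct

variable (Λ : Type) [AddCommGroup Λ]

theorem lexPos (X Z : Set Λ) (hX : IsPositivePart Λ X) (hZ : IsPositivePart Λ Z) :
    IsPositivePart Λ {a | a ∈ X ∧ (-a ∈ X → a ∈ Z)} := by
  obtain ⟨x1, x2, H, x3⟩ := hX
  obtain ⟨z1, z2, K, z3⟩ := hZ
  have tx : ∀ a, a ∈ X ∨ -a ∈ X := fun a => by
    have : a ∈ X ∪ (-X) := x1 ▸ Set.mem_univ a
    simpa using this
  have tz : ∀ a, a ∈ Z ∨ -a ∈ Z := fun a => by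
    have : a ∈ Z ∪ (-Z) := z1 ▸ Set.mem_univ a
    simpa using this
  refine ⟨?_, ?_, H ⊓ K, ?_⟩
  · ext a
    have h1 := tx a
    have h2 := tz a
    simp only [Set.mem_union, Set.mem_setOf_eq, Set.mem_neg, neg_neg, Set.mem_univ, iff_true]
    tauto
  · rintro a ⟨ha, ha'⟩ b ⟨hb, hb'⟩
    refine ⟨x2 a ha b hb, fun h => ?_⟩
    refine z2 a (ha' ?_) b (hb' ?_)
    · have := x2 b hb _ h
      simpa using this
    · have := x2 a ha _ h
      simpa using this
  · ext a
    have h1 : a ∈ H ↔ a ∈ X ∩ (-X) := by rw [← x3]; rfl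
    have h2 : a ∈ K ↔ a ∈ Z ∩ (-Z) := by rw [← z3]; rfl
    simp only [SetLike.mem_coe, AddSubgroup.mem_inf, h1, h2, Set.mem_inter_iff,
      Set.mem_setOf_eq, Set.mem_neg, neg_neg]
    tauto

theorem mem_UU_iff (E : Set Λ) (X : PosParts Λ) : X ∈ UU Λ E ↔ ∀ a ∈ E, a ∉ X.val := by
  simp only [UU, Set.mem_setOf_eq, Set.eq_empty_iff_forall_notMem, Set.mem_inter_iff]
  exact ⟨fun h a ha hx => h a ⟨hx, ha⟩, fun h a ha => h a ha.2 ha.1⟩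

theorem total_pos (X : PosParts Λ) (a : Λ) : a ∈ X.val ∨ -a ∈ X.val := by
  have : a ∈ X.val ∪ (-X.val) := X.2.1 ▸ Set.mem_univ a
  simpa using this

theorem statement10 [Module.Free ℤ Λ] [Module.Finite ℤ Λ] (E : Finset Λ)
    (hE : UU Λ (E : Set Λ) ≠ ∅) :
    closure (UU Λ (E : Set Λ)) = Set.univ \ ⋃ l ∈ E, UU Λ {-l} := by
  obtain ⟨Z, hZ⟩ := Set.nonempty_iff_ne_empty.mpr hE
  rw [mem_UU_iff] at hZ
  ext X
  simp only [Set.mem_diff, Set.mem_univ, true_and, Set.mem_iUnion, not_exists, mem_closure_iff]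
  constructor
  · intro h l hl hX
    have ho : IsOpen (UU Λ {-l}) := fun Y hY => ⟨{-l}, by simpa using hY, by simp⟩
    obtain ⟨Y, hY1, hY2⟩ := h _ ho hX
    rw [mem_UU_iff] at hY1 hY2
    have := total_pos Λ Y l
    have a1 := hY1 (-l) rfl
    have a2 := hY2 l hl
    tauto
  · intro h o ho hX
    obtain ⟨F, hF, hFo⟩ := ho X hX
    rw [mem_UU_iff] at hF
    refine ⟨⟨_, lexPos Λ X.val Z.val X.2 Z.2⟩, hFo ?_, ?_⟩
    · refine (mem_UU_iff Λ _ _).2 ?_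
      rintro a ha ⟨h1, _⟩
      exact hF a ha h1
    · refine (mem_UU_iff Λ _ _).2 ?_
      rintro a ha ⟨_, h2⟩
      have := h a ha
      rw [mem_UU_iff] at this
      refine hZ a ha (h2 ?_)
      by_contra hc
      apply this
      rintro b rfl
      exact hc
end

section
/- The map Pos̄ : V*/ℝ_{>0} → Pos(Λ) induces a homeomorphism onto its image, and its image is dense in Pos(Λ). -/
open scoped TensorProduct

variable (Λ : Type) [AddCommGroup Λ]

theorem isPositivePart_posSet (φ : Module.Dual ℝ (RV Λ)) :
    IsPositivePart Λ (PosSet Λ φ) := by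
  refine ⟨?_, ?_, ?_⟩
  · ext l
    simp only [Set.mem_union, Set.mem_neg, PosSet, Set.mem_setOf_eq, Set.mem_univ, iff_true,
      map_neg]
    rcases le_total 0 (φ (iota Λ l)) with h | h
    · exact Or.inl h
    · exact Or.inr (by simpa using h)
  · intro a ha b hb
    simp only [PosSet, Set.mem_setOf_eq, map_add] at *
    exact add_nonneg ha hb
  · refine ⟨AddMonoidHom.ker ((φ.toAddMonoidHom).comp (iota Λ).toAddMonoidHom), ?_⟩
    ext l
    simp only [SetLike.mem_coe, Set.mem_inter_iff, Set.mem_neg]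
    constructor
    · intro h
      have h' : φ (iota Λ l) = 0 := h
      constructor
      · exact le_of_eq h'.symm
      · show (0:ℝ) ≤ φ (iota Λ (-l))
        rw [map_neg, map_neg, h', neg_zero]
    · rintro ⟨h1, h2⟩
      have h1' : (0:ℝ) ≤ φ (iota Λ l) := h1
      have h2' : (0:ℝ) ≤ φ (iota Λ (-l)) := h2
      rw [map_neg, map_neg] at h2'
      show φ (iota Λ l) = 0
      linarith

/-- The map `Pos̄ : V*/ℝ_{>0} → Pos(Λ)` induced by `φ ↦ Pos(φ)`. -/
noncomputable def Posbar : DualQuot Λ → PosParts Λ :=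
  Quotient.lift (fun φ => (⟨PosSet Λ φ, isPositivePart_posSet Λ φ⟩ : PosParts Λ))
    (by
      rintro φ ψ ⟨κ, hκ, rfl⟩
      apply Subtype.ext
      ext l
      show (0:ℝ) ≤ φ (iota Λ l) ↔ (0:ℝ) ≤ (κ • φ) (iota Λ l)
      rw [LinearMap.smul_apply, smul_eq_mul]
      exact (mul_nonneg_iff_of_pos_left hκ).symm)

theorem aux_fm (n : ℕ) : ∀ (P : Set (Fin n → ℤ)), (∀ a ∈ P, ∀ b ∈ P, a + b ∈ P) → (0 ∉ P) →
    ∀ E : Finset (Fin n → ℤ), (∀ e ∈ E, e ∈ P) →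
    ∃ c : Fin n → ℝ, ∀ e ∈ E, ∑ i, c i * (e i : ℝ) < 0 := by
  classical
  induction n with
  | zero =>
    intro P hP h0 E hE
    refine ⟨0, fun e he => (h0 ?_).elim⟩
    have : e = 0 := Subsingleton.elim _ _
    exact this ▸ hE e he
  | succ n ih =>
    intro P hP h0 E hE
    have hmul : ∀ a ∈ P, ∀ k : ℤ, 0 < k → k • a ∈ P := by
      intro a ha k hk
      obtain ⟨m, rfl⟩ := Int.eq_ofNat_of_zero_le hk.le
      have hm : 0 < m := by simpa using hk
      clear hk
      induction m, hm using Nat.le_induction with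
      | base => simpa using ha
      | succ m hm ihm =>
        have := hP _ ihm _ ha
        convert this using 1
        push_cast
        rw [add_smul, one_smul]
    let P' : Set (Fin n → ℤ) := {x | (Fin.cons 0 x : Fin (n+1) → ℤ) ∈ P}
    have h1 : ∀ a ∈ P', ∀ b ∈ P', a + b ∈ P' := by
      intro a ha b hb
      have := hP _ ha _ hb
      change (Fin.cons 0 (a+b) : Fin (n+1) → ℤ) ∈ P
      convert this using 1
      ext i
      refine Fin.cases ?_ (fun j => ?_) i <;> simp
    have h2 : (0 : Fin n → ℤ) ∉ P' := by
      intro h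
      apply h0
      change (Fin.cons 0 0 : Fin (n+1) → ℤ) ∈ P at h
      convert h using 1
      ext i
      refine Fin.cases ?_ (fun j => ?_) i <;> simp
    let A := E.filter (fun e => 0 < e 0)
    let B := E.filter (fun e => e 0 < 0)
    let Z := E.filter (fun e => e 0 = 0)
    let E' : Finset (Fin n → ℤ) := Z.image Fin.tail ∪
      (A ×ˢ B).image (fun p => Fin.tail ((-(p.2 0)) • p.1 + (p.1 0) • p.2))
    obtain ⟨c, hc⟩ := ih P' h1 h2 E' (by
      intro e he
      simp only [E', Finset.mem_union, Finset.mem_image, Finset.mem_product, Prod.exists] at he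
      have key : ∀ x : Fin (n+1) → ℤ, x 0 = 0 → x ∈ P → Fin.tail x ∈ P' := by
        intro x hx hxP
        change (Fin.cons 0 (Fin.tail x) : Fin (n+1) → ℤ) ∈ P
        rw [← hx, Fin.cons_self_tail]
        exact hxP
      rcases he with ⟨x, hx, rfl⟩ | ⟨a, b, ⟨ha, hb⟩, rfl⟩
      · simp only [Z, Finset.mem_filter] at hx
        exact key x hx.2 (hE x hx.1)
      · simp only [A, B, Finset.mem_filter] at ha hb
        apply key
        · simp; ring
        · exact hP _ (hmul _ (hE _ ha.1) _ (by linarith [hb.2])) _ (hmul _ (hE _ hb.1) _ ha.2))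
    let s : (Fin (n+1) → ℤ) → ℝ := fun e => ∑ i, c i * (e (Fin.succ i) : ℝ)
    obtain ⟨t, ht1, ht2⟩ := Order.exists_between_finsets
      (lo := B.image (fun e => - s e / (e 0 : ℝ))) (hi := A.image (fun e => - s e / (e 0 : ℝ))) (by
        intro x hx y hy
        simp only [Finset.mem_image] at hx hy
        obtain ⟨b, hb, rfl⟩ := hx
        obtain ⟨a, ha, rfl⟩ := hy
        have := hc (Fin.tail ((-(b 0)) • a + (a 0) • b)) (by
          simp only [E', Finset.mem_union, Finset.mem_image, Finset.mem_product, Prod.exists]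
          exact Or.inr ⟨a, b, ⟨ha, hb⟩, rfl⟩)
        have hs : ∑ i, c i * ((Fin.tail ((-(b 0)) • a + (a 0) • b) i : ℤ) : ℝ)
            = (-(b 0 : ℝ)) * s a + (a 0 : ℝ) * s b := by
          simp only [s, Finset.mul_sum, ← Finset.sum_add_distrib]
          refine Finset.sum_congr rfl fun i _ => ?_
          simp only [Fin.tail, Pi.add_apply, Pi.smul_apply, smul_eq_mul]
          push_cast
          ring
        rw [hs] at this
        simp only [A, B, Finset.mem_filter] at ha hb
        have ha' : (0:ℝ) < a 0 := by exact_mod_cast ha.2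
        have hb' : (0:ℝ) < -(b 0 : ℝ) := by
          have : (b 0 : ℝ) < 0 := by exact_mod_cast hb.2
          linarith
        have e1 : - s b / (b 0 : ℝ) = s b / (-(b 0 : ℝ)) := by rw [div_neg, neg_div]
        rw [e1, div_lt_div_iff₀ hb' ha']
        linarith)
    refine ⟨Fin.cons t c, fun e he => ?_⟩
    rw [Fin.sum_univ_succ]
    simp only [Fin.cons_zero, Fin.cons_succ]
    change t * (e 0 : ℝ) + s e < 0
    rcases lt_trichotomy (e 0) 0 with h | h | h
    · have := ht1 (- s e / (e 0 : ℝ)) (Finset.mem_image.2 ⟨e, by simp [B, he, h], rfl⟩)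
      have h' : (e 0 : ℝ) < 0 := by exact_mod_cast h
      rw [div_lt_iff_of_neg h'] at this
      linarith
    · have := hc (Fin.tail e) (by
        simp only [E', Finset.mem_union, Finset.mem_image]
        exact Or.inl ⟨e, by simp [Z, he, h], rfl⟩)
      have : s e < 0 := this
      simp [h, this]
    · have := ht2 (- s e / (e 0 : ℝ)) (Finset.mem_image.2 ⟨e, by simp [A, he, h], rfl⟩)
      have h' : (0:ℝ) < (e 0 : ℝ) := by exact_mod_cast h
      rw [lt_div_iff₀ h'] at this
      linarith

theorem aux_iota (l : Λ) : iota Λ l = (1 : ℝ) ⊗ₜ[ℤ] l := rfl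

theorem aux_isOpen_UU (E : Finset Λ) : IsOpen (UU Λ (E : Set Λ)) :=
  fun _ hX => ⟨E, hX, subset_rfl⟩

theorem aux_mem_UU (X : PosParts Λ) (E : Set Λ) : X ∈ UU Λ E ↔ ∀ e ∈ E, e ∉ X.val := by
  change X.val ∩ E = ∅ ↔ _
  rw [← Set.disjoint_iff_inter_eq_empty, Set.disjoint_right]

theorem aux_dense [Module.Free ℤ Λ] [Module.Finite ℤ Λ] : Dense (Set.range (Posbar Λ)) := by
  classical
  intro X
  rw [mem_closure_iff]
  intro U hU hXU
  obtain ⟨E, hE, hEU⟩ := hU X hXU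
  obtain ⟨hun, hadd, H, hH⟩ := X.2
  have hneg : ∀ a, a ∉ X.val → -a ∈ X.val := by
    intro a ha
    have : a ∈ X.val ∪ -X.val := hun ▸ Set.mem_univ a
    rcases this with h | h
    · exact (ha h).elim
    · exact h
  have h0 : (0 : Λ) ∈ X.val := by
    have : (0 : Λ) ∈ (H : Set Λ) := H.zero_mem
    rw [hH] at this
    exact this.1
  let b := Module.finBasis ℤ Λ
  obtain ⟨c, hc⟩ := aux_fm _ {x | b.equivFun.symm x ∉ X.val} (by
      intro x hx y hy hxy
      apply hx
      rw [map_add] at hxy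
      have := hadd _ hxy _ (hneg _ hy)
      simpa using this) (by simpa using h0) (E.image b.equivFun) (by
      intro e he
      obtain ⟨l, hl, rfl⟩ := Finset.mem_image.1 he
      have := (aux_mem_UU Λ X E).1 hE l hl
      simpa using this)
  let f : Λ →ₗ[ℤ] ℝ := b.constr ℤ c
  let φ : Module.Dual ℝ (RV Λ) := f.liftBaseChange ℝ
  refine ⟨Posbar Λ (Quotient.mk _ φ), hEU ?_, ⟨_, rfl⟩⟩
  rw [aux_mem_UU]
  intro l hl
  change ¬ (0 ≤ φ (iota Λ l))
  have h := hc (b.equivFun l) (Finset.mem_image_of_mem _ hl)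
  have : φ (iota Λ l) = ∑ i, c i * ((b.equivFun l i : ℤ) : ℝ) := by
    rw [aux_iota]
    simp only [φ, LinearMap.liftBaseChange_tmul, one_smul, f]
    rw [Module.Basis.constr_apply_fintype]
    refine Finset.sum_congr rfl fun i _ => ?_
    rw [zsmul_eq_mul, mul_comm]
  rw [this]
  exact not_le.2 h

open Filter Topology

noncomputable def auxPos (φ : Module.Dual ℝ (RV Λ)) : PosParts Λ := Posbar Λ (Quotient.mk _ φ)

theorem aux_eval_cont (v : RV Λ) : Continuous (fun φ : Module.Dual ℝ (RV Λ) => φ v) :=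
  continuous_iInf_dom continuous_induced_dom

theorem aux_tendsto_dual {α : Type*} {F : Filter α} {g : α → Module.Dual ℝ (RV Λ)}
    {φ : Module.Dual ℝ (RV Λ)}
    (h : ∀ v, Tendsto (fun x => g x v) F (𝓝 (φ v))) : Tendsto g F (𝓝 φ) := by
  rw [nhds_iInf, tendsto_iInf]
  intro v
  rw [nhds_induced, tendsto_comap_iff]
  exact h v

theorem aux_mem_auxPos (φ : Module.Dual ℝ (RV Λ)) (E : Set Λ) :
    auxPos Λ φ ∈ UU Λ E ↔ ∀ e ∈ E, φ (iota Λ e) < 0 := by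
  rw [aux_mem_UU]
  refine forall₂_congr fun e _ => ?_
  change ¬ (0 ≤ φ (iota Λ e)) ↔ _
  exact not_le

theorem aux_cont : Continuous (auxPos Λ) := by
  rw [continuous_def]
  intro U hU
  rw [isOpen_iff_mem_nhds]
  intro φ hφ
  obtain ⟨E, hE, hEU⟩ := hU _ hφ
  rw [aux_mem_auxPos] at hE
  have : ∀ᶠ ψ in 𝓝 φ, ∀ e ∈ E, ψ (iota Λ e) < 0 := by
    rw [Filter.eventually_all_finset]
    intro e he
    exact (aux_eval_cont Λ (iota Λ e)).continuousAt.eventually_lt continuousAt_const (hE e he)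
  filter_upwards [this] with ψ hψ
  exact hEU ((aux_mem_auxPos Λ ψ E).2 hψ)

theorem aux_factA (φ : Module.Dual ℝ (RV Λ)) (l : Λ) (h : φ (iota Λ l) < 0) :
    ∀ᶠ ψ in comap (auxPos Λ) (𝓝 (auxPos Λ φ)), ψ (iota Λ l) < 0 := by
  have h1 : UU Λ (({l} : Finset Λ) : Set Λ) ∈ 𝓝 (auxPos Λ φ) :=
    (aux_isOpen_UU Λ {l}).mem_nhds ((aux_mem_auxPos Λ φ _).2 (by simpa using h))
  filter_upwards [preimage_mem_comap h1] with ψ hψ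
  exact (aux_mem_auxPos Λ ψ _).1 hψ l (by simp)

noncomputable def auxN (e : Λ) (ψ : Module.Dual ℝ (RV Λ)) : Module.Dual ℝ (RV Λ) :=
  (-(ψ (iota Λ e)))⁻¹ • ψ

theorem aux_factB (φ : Module.Dual ℝ (RV Λ)) (e : Λ) (h : φ (iota Λ e) < 0) :
    Tendsto (auxN Λ e) (comap (auxPos Λ) (𝓝 (auxPos Λ φ))) (𝓝 (auxN Λ e φ)) := by
  apply aux_tendsto_dual
  have hl : ∀ l : Λ, Tendsto (fun ψ => auxN Λ e ψ (iota Λ l))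
      (comap (auxPos Λ) (𝓝 (auxPos Λ φ))) (𝓝 (auxN Λ e φ (iota Λ l))) := by
    intro l
    have hval : ∀ ψ : Module.Dual ℝ (RV Λ),
        auxN Λ e ψ (iota Λ l) = ψ (iota Λ l) / (-(ψ (iota Λ e))) := by
      intro ψ
      simp only [auxN, LinearMap.smul_apply, smul_eq_mul]
      rw [div_eq_inv_mul]
    have key : ∀ (ψ : Module.Dual ℝ (RV Λ)) (r : ℚ) (s : ℤ), ψ (iota Λ e) < 0 →
        (ψ (iota Λ (s • ((r.den : ℤ) • l + r.num • e))) < 0 ↔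
          s * (auxN Λ e ψ (iota Λ l) - r) < 0) := by
      intro ψ r s hψ
      have hd : (0:ℝ) < r.den := by exact_mod_cast r.den_pos
      have hr : (r : ℝ) = r.num / r.den := by exact_mod_cast (Rat.num_div_den r).symm
      have : ψ (iota Λ (s • ((r.den : ℤ) • l + r.num • e))) =
          (s * (auxN Λ e ψ (iota Λ l) - r)) * (r.den * (-(ψ (iota Λ e)))) := by
        rw [hval, hr]
        simp only [map_zsmul, map_add, zsmul_eq_mul]
        have := hψ.ne
        push_cast
        field_simp
        ring
      rw [this]
      have hp : 0 < (r.den * (-(ψ (iota Λ e)))) := mul_pos hd (by linarith)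
      constructor
      · intro hh
        by_contra hcon
        exact absurd (mul_nonneg (not_lt.1 hcon) hp.le) (not_le.2 hh)
      · intro hh
        exact mul_neg_of_neg_of_pos hh hp
    rw [tendsto_order]
    constructor
    · intro a ha
      obtain ⟨r, har, hr⟩ := exists_rat_btwn ha
      have := aux_factA Λ φ _ ((key φ r (-1) h).2 (by push_cast; linarith))
      filter_upwards [this, aux_factA Λ φ e h] with ψ h1 h2
      have := (key ψ r (-1) h2).1 h1
      push_cast at this
      linarith
    · intro a ha
      obtain ⟨r, har, hr⟩ := exists_rat_btwn ha
      have := aux_factA Λ φ _ ((key φ r 1 h).2 (by push_cast; linarith))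
      filter_upwards [this, aux_factA Λ φ e h] with ψ h1 h2
      have := (key ψ r 1 h2).1 h1
      push_cast at this
      linarith
  intro v
  induction v using TensorProduct.induction_on with
  | zero => simp only [map_zero]; exact tendsto_const_nhds
  | tmul r l =>
    have : (r ⊗ₜ[ℤ] l : RV Λ) = r • iota Λ l := by
      rw [aux_iota, TensorProduct.smul_tmul', smul_eq_mul, mul_one]
    rw [this]
    simp only [map_smul]
    exact (hl l).const_smul r
  | add x y hx hy =>
    simp only [map_add]
    exact hx.add hy

theorem aux_N_equiv (e : Λ) (ψ : Module.Dual ℝ (RV Λ)) (h : ψ (iota Λ e) < 0) :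
    (Quotient.mk (dualSetoid Λ) (auxN Λ e ψ)) = Quotient.mk (dualSetoid Λ) ψ := by
  symm
  apply Quotient.sound
  exact ⟨(-(ψ (iota Λ e)))⁻¹, inv_pos.2 (by linarith), rfl⟩

theorem aux_zero (φ : Module.Dual ℝ (RV Λ)) (h : ∀ l, ¬ φ (iota Λ l) < 0) : φ = 0 := by
  have h0 : ∀ l, φ (iota Λ l) = 0 := by
    intro l
    have h1 := h l
    have h2 := h (-l)
    rw [map_neg, map_neg] at h2
    linarith
  ext v
  have := h0 v
  rw [aux_iota] at this
  simpa using this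

theorem aux_inj : Function.Injective (Posbar Λ) := by
  intro p q
  induction p using Quotient.inductionOn with | _ φ
  induction q using Quotient.inductionOn with | _ ψ
  intro h
  change auxPos Λ φ = auxPos Λ ψ at h
  have hneg : ∀ l, φ (iota Λ l) < 0 ↔ ψ (iota Λ l) < 0 := by
    intro l
    have h1 := aux_mem_auxPos Λ φ {l}
    have h2 := aux_mem_auxPos Λ ψ {l}
    rw [h] at h1
    simpa using h1.symm.trans h2
  by_cases hz : ∃ e, φ (iota Λ e) < 0
  · obtain ⟨e, he⟩ := hz
    rw [← aux_N_equiv Λ e φ he, ← aux_N_equiv Λ e ψ ((hneg e).1 he)]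
    congr 1
    have hp : pure ψ ≤ comap (auxPos Λ) (𝓝 (auxPos Λ φ)) := by
      rw [← map_le_iff_le_comap, map_pure, h]
      exact pure_le_nhds _
    have ht := (aux_factB Λ φ e he).mono_left hp
    refine LinearMap.ext fun v => ?_
    have h3 := ((aux_eval_cont Λ v).tendsto _).comp ht
    have h4 := tendsto_pure_nhds (fun ψ => auxN Λ e ψ v) ψ
    exact tendsto_nhds_unique h3 h4
  · push Not at hz
    rw [aux_zero Λ φ (fun l => not_lt.2 (hz l)),
      aux_zero Λ ψ (fun l hl => not_lt.2 (hz l) ((hneg l).2 hl))]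

theorem aux_inducing : IsInducing (Posbar Λ) := by
  rw [isInducing_iff_nhds]
  intro p
  induction p using Quotient.inductionOn with | _ φ
  have hcont : Continuous (Posbar Λ) :=
    (isQuotientMap_quotient_mk' (s := dualSetoid Λ)).continuous_iff.2 (aux_cont Λ)
  apply le_antisymm
  · exact (hcont.tendsto _).le_comap
  · intro S hS
    obtain ⟨W, hWS, hWo, hφW⟩ := mem_nhds_iff.1 hS
    have hWo' : IsOpen ((Quotient.mk (dualSetoid Λ)) ⁻¹' W) :=
      hWo.preimage continuous_quotient_mk'
    have hmain : (Quotient.mk (dualSetoid Λ)) ⁻¹' W ∈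
        comap (auxPos Λ) (𝓝 (auxPos Λ φ)) := by
      by_cases hz : ∃ e, φ (iota Λ e) < 0
      · obtain ⟨e, he⟩ := hz
        have hN : (Quotient.mk (dualSetoid Λ)) ⁻¹' W ∈ 𝓝 (auxN Λ e φ) := by
          apply hWo'.mem_nhds
          change Quotient.mk (dualSetoid Λ) _ ∈ W
          rw [aux_N_equiv Λ e φ he]
          exact hφW
        filter_upwards [aux_factB Λ φ e he hN, aux_factA Λ φ e he] with ψ h1 h2
        change Quotient.mk (dualSetoid Λ) (auxN Λ e ψ) ∈ W at h1
        rw [aux_N_equiv Λ e ψ h2] at h1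
        exact h1
      · push Not at hz
        have h0 := aux_zero Λ φ (fun l => not_lt.2 (hz l))
        subst h0
        convert univ_mem
        rw [Set.eq_univ_iff_forall]
        intro ψ
        have ht : Tendsto (fun t : ℝ => t • ψ) (𝓝[>] 0) (𝓝 0) := by
          apply aux_tendsto_dual
          intro v
          have : Tendsto (fun t : ℝ => t * ψ v) (𝓝 0) (𝓝 (0 * ψ v)) :=
            tendsto_id.mul_const _
          rw [zero_mul] at this
          exact this.mono_left nhdsWithin_le_nhds
        obtain ⟨t, ht1, ht2⟩ :=
          ((ht.eventually (hWo'.mem_nhds hφW)).and self_mem_nhdsWithin).exists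
        have heq : Quotient.mk (dualSetoid Λ) ψ = Quotient.mk (dualSetoid Λ) (t • ψ) :=
          Quotient.sound ⟨t, ht2, rfl⟩
        change Quotient.mk (dualSetoid Λ) ψ ∈ W
        rw [heq]
        exact ht1
    obtain ⟨U, hU, hUW⟩ := mem_comap.1 hmain
    refine mem_comap.2 ⟨U, hU, fun q hq => hWS ?_⟩
    induction q using Quotient.inductionOn with | _ ψ
    exact hUW hq

theorem statement13 [Module.Free ℤ Λ] [Module.Finite ℤ Λ] :
    Topology.IsEmbedding (Posbar Λ) ∧ Dense (Set.range (Posbar Λ)) := by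
  exact ⟨⟨aux_inducing Λ, aux_inj Λ⟩, aux_dense Λ⟩
end

section
/- For every λ ∈ Λ, the set π^{-1}(V(λ)) is an open subset of Pos(Λ), where V(λ) = {φ̄ ∈ V*/ℝ_{>0} | φ(λ) < 0}. -/
open scoped TensorProduct

variable (Λ : Type) [AddCommGroup Λ]

/-- `V(E) = {φ̄ ∈ V*/ℝ_{>0} | φ(λ) < 0 for all λ ∈ E}`. -/
def VQ (E : Set Λ) : Set (DualQuot Λ) :=
  {q | ∀ φ : Module.Dual ℝ (RV Λ), Quotient.mk (dualSetoid Λ) φ = q → ∀ l ∈ E, φ (iota Λ l) < 0}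

theorem statement15 [Module.Free ℤ Λ] [Module.Finite ℤ Λ] (π : PosParts Λ → DualQuot Λ) (hπ : IsPi Λ π) (l : Λ) :
    IsOpen (π ⁻¹' VQ Λ {l}) := by
  classical
  intro X hX
  obtain ⟨φ, h1, h2, -⟩ := hπ X
  have hl : φ (iota Λ l) < 0 := hX φ h1.symm l rfl
  obtain ⟨S, hS⟩ := (Module.Finite.fg_top : (⊤ : Submodule ℤ Λ).FG)
  obtain ⟨n, hn⟩ : ∃ n : ℕ, ∀ b ∈ S, |φ (iota Λ b)| < n * (-φ (iota Λ l)) := by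
    obtain ⟨n, hn⟩ := exists_nat_gt ((∑ b ∈ S, |φ (iota Λ b)|) / (-φ (iota Λ l)))
    refine ⟨n, fun b hb => ?_⟩
    rw [div_lt_iff₀ (by linarith)] at hn
    exact lt_of_le_of_lt
      (Finset.single_le_sum (f := fun b => |φ (iota Λ b)|) (fun _ _ => abs_nonneg _) hb) hn
  have hnot : ∀ x : Λ, φ (iota Λ x) < 0 → x ∉ X.val := fun x hx hm =>
    absurd (h2 hm) (not_le.2 hx)
  refine ⟨insert l (S.image (fun b => n • l + b) ∪ S.image (fun b => n • l - b)), ?_, ?_⟩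
  · apply Set.eq_empty_of_forall_notMem
    rintro x ⟨hx, hxE⟩
    refine hnot x ?_ hx
    simp only [Finset.coe_insert, Finset.coe_union, Finset.coe_image, Set.mem_insert_iff,
      Set.mem_union, Set.mem_image, Finset.mem_coe] at hxE
    rcases hxE with rfl | ⟨b, hb, rfl⟩ | ⟨b, hb, rfl⟩
    · exact hl
    · have := abs_lt.1 (hn b hb)
      simp only [map_add, map_nsmul, nsmul_eq_mul]
      linarith
    · have := abs_lt.1 (hn b hb)
      simp only [map_sub, map_nsmul, nsmul_eq_mul]
      linarith
  · intro Y hY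
    obtain ⟨ψ, g1, g2, g3⟩ := hπ Y
    have hE : ∀ x ∈ insert l (S.image (fun b => n • l + b) ∪ S.image (fun b => n • l - b)),
        x ∉ Y.val := fun x hx hy => by
      have : x ∈ (∅ : Set Λ) := hY ▸ (⟨hy, hx⟩ : x ∈ Y.val ∩ _)
      exact this
    have hneg : ∀ x : Λ, x ∉ Y.val → ψ (iota Λ x) ≤ 0 := fun x hx => by
      have : x ∈ Y.val ∪ -Y.val := by rw [Y.2.1]; trivial
      have h : 0 ≤ ψ (iota Λ (-x)) := g2 (this.resolve_left hx)
      simp only [map_neg] at h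
      linarith
    have hlY : l ∉ Y.val := hE l (by simp)
    have hψ0 : ψ ≠ 0 := g3 (fun h => hlY (by rw [h]; trivial))
    have hψl : ψ (iota Λ l) < 0 := by
      by_contra hc
      push Not at hc
      have hz : ∀ b ∈ S, ψ (iota Λ b) = 0 := fun b hb => by
        have e1 := hneg _ (hE (n • l + b) (by
          simp only [Finset.mem_insert, Finset.mem_union, Finset.mem_image]
          exact Or.inr (Or.inl ⟨b, hb, rfl⟩)))
        have e2 := hneg _ (hE (n • l - b) (by
          simp only [Finset.mem_insert, Finset.mem_union, Finset.mem_image]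
          exact Or.inr (Or.inr ⟨b, hb, rfl⟩)))
        simp only [map_add, map_sub, map_nsmul, nsmul_eq_mul] at e1 e2
        have : 0 ≤ (n : ℝ) * ψ (iota Λ l) := by positivity
        linarith
      have hall : ∀ x : Λ, ψ (iota Λ x) = 0 := fun x => by
        have hx : x ∈ Submodule.span ℤ (S : Set Λ) := by rw [hS]; trivial
        induction hx using Submodule.span_induction with
        | mem x h => exact hz x h
        | zero => simp
        | add x y _ _ hx hy => simp [hx, hy]
        | smul a x _ hx => simp [map_zsmul, hx]
      apply hψ0
      ext v
      have h := hall v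
      change ψ (1 ⊗ₜ[ℤ] v) = 0 at h
      simpa using h
    intro ψ' hψ' x hx
    rw [Set.mem_singleton_iff] at hx
    subst hx
    rw [g1] at hψ'
    obtain ⟨κ, hκ, rfl⟩ := Quotient.exact hψ'.symm
    simpa using mul_neg_of_pos_of_neg hκ hψl
end

section
/- Let E be a subset of Λ, let Λ(E) = Λ ∩ Σ_{λ∈E} ℚλ (the intersection of Λ with the ℚ-span of E in ℚ ⊗_ℤ Λ), and let σ_E : Λ → Λ/Λ(E) be the canonical projection. Then: (a) L(E) = ⋂_{λ ∈ E, λ ≠ 0} H_λ = {X ∈ Pos(Λ) | Λ(E) ⊆ X}; (b) L(E) is closed in Pos(Λ); (c) {φ ∈ V* | Pos(φ) ∈ L(E)} = {φ ∈ V* | φ(λ) = 0 for all λ ∈ E}; (d) the map σ_E* : Pos(Λ/Λ(E)) → Pos(Λ), Y ↦ σ_E^{-1}(Y), has image L(E) and induces a homeomorphism from Pos(Λ/Λ(E)) onto L(E). -/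
open scoped TensorProduct

variable (Λ : Type) [AddCommGroup Λ]

theorem isPositivePart_preimage {A B : Type} [AddCommGroup A] [AddCommGroup B]
    (σ : A →+ B) {X : Set B} (hX : IsPositivePart B X) :
    IsPositivePart A (σ ⁻¹' X) := by
  obtain ⟨h1, h2, H, hH⟩ := hX
  refine ⟨?_, ?_, ?_⟩
  · ext x
    simp only [Set.mem_union, Set.mem_preimage, Set.mem_neg, map_neg, Set.mem_univ, iff_true]
    have hx : σ x ∈ X ∪ (-X) := h1 ▸ Set.mem_univ _
    rcases hx with h | h
    · exact Or.inl h
    · exact Or.inr (by simpa using h)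
  · intro a ha b hb
    simp only [Set.mem_preimage, map_add] at *
    exact h2 _ ha _ hb
  · refine ⟨H.comap σ, ?_⟩
    ext x
    have hmem : σ x ∈ H ↔ σ x ∈ X ∩ (-X) := by
      constructor
      · intro h; rw [← hH]; exact h
      · intro h; rw [← hH] at h; exact h
    constructor
    · intro h
      have h' : σ x ∈ X ∩ (-X) := hmem.1 h
      exact ⟨h'.1, by simpa [Set.mem_neg, Set.mem_preimage, map_neg] using h'.2⟩
    · rintro ⟨hx1, hx2⟩
      exact hmem.2 ⟨hx1, by simpa [Set.mem_neg, Set.mem_preimage, map_neg] using hx2⟩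

/-- `L(E) = {X ∈ Pos(Λ) | E ⊆ X ∩ (-X)}`, a rational subspace of `Pos(Λ)`. -/
def LL (E : Set Λ) : Set (PosParts Λ) := {X | E ⊆ X.val ∩ (-X.val)}

/-- The rational hyperplane `H_λ = L({λ})`. -/
def HH (l : Λ) : Set (PosParts Λ) := LL Λ {l}

/-- The canonical map `Λ → ℚ ⊗_ℤ Λ`, `λ ↦ 1 ⊗ λ`. -/
noncomputable def iotaQ : Λ →ₗ[ℤ] ℚ ⊗[ℤ] Λ := TensorProduct.mk ℤ ℚ Λ 1

/-- `Λ(E) = Λ ∩ Σ_{λ ∈ E} ℚλ`, the intersection of `Λ` with the `ℚ`-span of `E`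
inside `ℚ ⊗_ℤ Λ`. -/
noncomputable def latE (E : Set Λ) : AddSubgroup Λ :=
  AddSubgroup.comap (iotaQ Λ).toAddMonoidHom
    (Submodule.span ℚ (iotaQ Λ '' E)).toAddSubgroup

/-- `σ_E* : Pos(Λ/Λ(E)) → Pos(Λ)`, `Y ↦ σ_E^{-1}(Y)` where `σ_E : Λ → Λ/Λ(E)` is the
canonical projection. -/
noncomputable def sigmaEStar (E : Set Λ) :
    PosParts (Λ ⧸ latE Λ E) → PosParts Λ :=
  fun Y => ⟨(QuotientAddGroup.mk' (latE Λ E)) ⁻¹' Y.val,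
    isPositivePart_preimage (QuotientAddGroup.mk' (latE Λ E)) Y.property⟩

theorem aux_zero_s18 {Λ : Type} [AddCommGroup Λ] {X : Set Λ} (hX : IsPositivePart Λ X) :
    (0 : Λ) ∈ X := by
  have h : (0 : Λ) ∈ X ∪ (-X) := hX.1 ▸ Set.mem_univ _
  rcases h with h | h
  · exact h
  · simpa using h

theorem aux_nsmul {Λ : Type} [AddCommGroup Λ] {X : Set Λ} (hX : IsPositivePart Λ X)
    {a : Λ} (ha : a ∈ X) (n : ℕ) : n • a ∈ X := by
  induction n with
  | zero => simpa using aux_zero_s18 hX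
  | succ n ih => rw [succ_nsmul]; exact hX.2.1 _ ih _ ha

theorem aux_sat {Λ : Type} [AddCommGroup Λ] {X : Set Λ} (hX : IsPositivePart Λ X)
    {a : Λ} {n : ℕ} (hn : 0 < n) (h1 : n • a ∈ X) : a ∈ X := by
  have h : a ∈ X ∪ (-X) := hX.1 ▸ Set.mem_univ _
  rcases h with h | h
  · exact h
  · have h3 := aux_nsmul hX (Set.mem_neg.1 h) (n - 1)
    have h4 := hX.2.1 _ h3 _ h1
    obtain ⟨m, rfl⟩ : ∃ m, n = m + 1 := ⟨n - 1, by omega⟩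
    have h5 : (m + 1 - 1) • (-a) + (m + 1) • a = a := by
      rw [Nat.add_sub_cancel, succ_nsmul, smul_neg]; abel
    rwa [h5] at h4

theorem aux_span {Λ : Type} [AddCommGroup Λ] (E : Set Λ) (H : AddSubgroup Λ) (hE : E ⊆ H)
    (x : ℚ ⊗[ℤ] Λ) (hx : x ∈ Submodule.span ℚ (iotaQ Λ '' E)) :
    ∃ n : ℕ, 0 < n ∧ ∃ h ∈ H, (n : ℚ) • x = iotaQ Λ h := by
  induction hx using Submodule.span_induction with
  | mem x hx =>
    obtain ⟨e, he, rfl⟩ := hx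
    exact ⟨1, one_pos, e, hE he, by simp⟩
  | zero => exact ⟨1, one_pos, 0, H.zero_mem, by simp⟩
  | add x y _ _ hx hy =>
    obtain ⟨n, hn, a, ha, hna⟩ := hx
    obtain ⟨m, hm, b, hb, hmb⟩ := hy
    refine ⟨n * m, Nat.mul_pos hn hm, m • a + n • b,
      H.add_mem (H.nsmul_mem ha m) (H.nsmul_mem hb n), ?_⟩
    rw [map_add, map_nsmul, map_nsmul, ← hna, ← hmb, ← Nat.cast_smul_eq_nsmul ℚ m,
      ← Nat.cast_smul_eq_nsmul ℚ n]
    push_cast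
    module
  | smul q x _ hx =>
    obtain ⟨n, hn, a, ha, hna⟩ := hx
    refine ⟨q.den * n, Nat.mul_pos q.den_pos hn, q.num • a, H.zsmul_mem ha _, ?_⟩
    rw [map_zsmul, ← hna, ← Int.cast_smul_eq_zsmul ℚ q.num, smul_smul, smul_smul]
    congr 1
    push_cast
    rw [← Rat.den_mul_eq_num q]
    ring

theorem aux_iotaQ_inj {Λ : Type} [AddCommGroup Λ] [Module.Free ℤ Λ] :
    Function.Injective (iotaQ Λ) :=
  Module.Flat.tensorProduct_mk_injective (R := ℤ) (S := ℚ) (M := Λ)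

theorem aux_latE_mem {Λ : Type} [AddCommGroup Λ] (E : Set Λ) {l : Λ} (hl : l ∈ E) :
    l ∈ latE Λ E :=
  Submodule.subset_span (Set.mem_image_of_mem _ hl)

theorem aux_LL {Λ : Type} [AddCommGroup Λ] [Module.Free ℤ Λ] (E : Set Λ) :
    LL Λ E = {X : PosParts Λ | (latE Λ E : Set Λ) ⊆ X.val} := by
  ext X
  constructor
  · intro hX l hl
    obtain ⟨H, hH⟩ := X.2.2.2
    have hE : E ⊆ H := by rw [hH]; exact hX
    obtain ⟨n, hn, a, ha, hna⟩ := aux_span E H hE (iotaQ Λ l) hl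
    rw [Nat.cast_smul_eq_nsmul, ← map_nsmul] at hna
    have h2 := aux_iotaQ_inj hna
    apply aux_sat X.2 hn
    rw [h2]
    have : a ∈ (H : Set Λ) := ha
    rw [hH] at this
    exact this.1
  · intro hX l hl
    exact ⟨hX (aux_latE_mem E hl), hX (neg_mem (aux_latE_mem E hl))⟩

theorem aux_closed {Λ : Type} [AddCommGroup Λ] (E : Set Λ) : IsClosed (LL Λ E) := by
  rw [← isOpen_compl_iff]
  intro X hX
  have hX' : ¬ E ⊆ X.val ∩ (-X.val) := hX
  rw [Set.not_subset] at hX'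
  obtain ⟨l, hl, hlX⟩ := hX'
  by_cases h : l ∈ X.val
  · have h2 : -l ∉ X.val := fun h2 => hlX ⟨h, h2⟩
    refine ⟨{-l}, ?_, ?_⟩
    · simpa [UU] using h2
    · intro Y hY hYL
      have hY' : -l ∉ Y.val := by simpa [UU] using hY
      exact hY' (hYL hl).2
  · refine ⟨{l}, ?_, ?_⟩
    · simpa [UU] using h
    · intro Y hY hYL
      have hY' : l ∉ Y.val := by simpa [UU] using hY
      exact hY' (hYL hl).1

theorem aux_range {Λ : Type} [AddCommGroup Λ] [Module.Free ℤ Λ] (E : Set Λ) :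
    Set.range (sigmaEStar Λ E) = LL Λ E := by
  rw [aux_LL]
  ext X
  constructor
  · rintro ⟨Y, rfl⟩ l hl
    show (QuotientAddGroup.mk' (latE Λ E)) l ∈ Y.val
    have : (QuotientAddGroup.mk' (latE Λ E)) l = 0 := (QuotientAddGroup.eq_zero_iff l).2 hl
    rw [this]
    exact aux_zero_s18 Y.2
  · intro hX
    have key : ∀ a : Λ, (QuotientAddGroup.mk' (latE Λ E)) a ∈
        (QuotientAddGroup.mk' (latE Λ E)) '' X.val ↔ a ∈ X.val := by
      intro a
      constructor
      · rintro ⟨b, hb, hab⟩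
        have h1 : -b + a ∈ latE Λ E := QuotientAddGroup.eq.1 hab
        have h2 := X.2.2.1 _ hb _ (hX h1)
        simpa using h2
      · intro h
        exact ⟨a, h, rfl⟩
    refine ⟨⟨(QuotientAddGroup.mk' (latE Λ E)) '' X.val, ?_, ?_, ?_⟩, ?_⟩
    · ext q
      obtain ⟨a, rfl⟩ := QuotientAddGroup.mk'_surjective _ q
      simp only [Set.mem_union, Set.mem_neg, Set.mem_univ, iff_true]
      rw [← map_neg, key, key]
      have h : a ∈ X.val ∪ (-X.val) := X.2.1 ▸ Set.mem_univ _
      exact h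
    · rintro _ ⟨a, ha, rfl⟩ _ ⟨b, hb, rfl⟩
      rw [← map_add, key]
      exact X.2.2.1 _ ha _ hb
    · obtain ⟨H, hH⟩ := X.2.2.2
      refine ⟨H.map (QuotientAddGroup.mk' (latE Λ E)), ?_⟩
      rw [AddSubgroup.coe_map, hH]
      ext q
      constructor
      · rintro ⟨a, ha, rfl⟩
        refine ⟨(key a).2 ha.1, ?_⟩
        rw [Set.mem_neg, ← map_neg, key]
        exact ha.2
      · obtain ⟨a, rfl⟩ := QuotientAddGroup.mk'_surjective _ q
        rintro ⟨h1, h2⟩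
        rw [Set.mem_neg, ← map_neg, key] at h2
        exact ⟨a, ⟨(key a).1 h1, h2⟩, rfl⟩
    · apply Subtype.ext
      ext a
      exact key a

theorem aux_inj_s18 {Λ : Type} [AddCommGroup Λ] (E : Set Λ) :
    Function.Injective (sigmaEStar Λ E) := by
  intro Y Z h
  apply Subtype.ext
  exact Set.preimage_injective.2 (QuotientAddGroup.mk'_surjective (latE Λ E))
    (congrArg Subtype.val h)

theorem aux_UU {Λ : Type} [AddCommGroup Λ] (X : PosParts Λ) (F : Set Λ) :
    X ∈ UU Λ F ↔ ∀ a ∈ F, a ∉ X.val := by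
  show X.val ∩ F = ∅ ↔ _
  rw [Set.eq_empty_iff_forall_notMem]
  exact ⟨fun h a ha hX => h a ⟨hX, ha⟩, fun h a ha => h a ha.2 ha.1⟩

theorem aux_emb {Λ : Type} [AddCommGroup Λ] (E : Set Λ) :
    Topology.IsEmbedding (sigmaEStar Λ E) := by
  classical
  refine ⟨⟨?_⟩, aux_inj_s18 E⟩
  ext U
  rw [isOpen_induced_iff]
  constructor
  · intro hU
    refine ⟨{X | ∃ F : Finset Λ, X ∈ UU Λ (F : Set Λ) ∧
      sigmaEStar Λ E ⁻¹' (UU Λ (F : Set Λ)) ⊆ U}, ?_, ?_⟩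
    · rintro X ⟨F, hF, hFU⟩
      exact ⟨F, hF, fun Y hY => ⟨F, hY, hFU⟩⟩
    · ext Y
      constructor
      · rintro ⟨F, hF, hFU⟩
        exact hFU hF
      · intro hY
        obtain ⟨F, hF, hFU⟩ := hU Y hY
        have key : ∀ Z, sigmaEStar Λ E Z ∈
            UU Λ ((F.image (fun q => Quotient.out q) : Finset Λ) : Set Λ) ↔
            Z ∈ UU (Λ ⧸ latE Λ E) (F : Set (Λ ⧸ latE Λ E)) := by
          intro Z
          have hout : ∀ q : Λ ⧸ latE Λ E,
              q.out ∈ (sigmaEStar Λ E Z).val ↔ q ∈ Z.val := by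
            intro q
            show (QuotientAddGroup.mk' (latE Λ E)) q.out ∈ Z.val ↔ _
            rw [QuotientAddGroup.mk'_apply, QuotientAddGroup.out_eq']
          rw [aux_UU, aux_UU]
          simp [hout]
          rfl
        refine ⟨F.image (fun q => Quotient.out q), (key Y).2 hF, ?_⟩
        intro Z hZ
        exact hFU ((key Z).1 hZ)
  · rintro ⟨W, hW, rfl⟩ Y hY
    obtain ⟨F, hF, hFW⟩ := hW _ hY
    have key : ∀ Z, Z ∈ UU (Λ ⧸ latE Λ E)
        ((F.image (QuotientAddGroup.mk' (latE Λ E)) : Finset _) : Set (Λ ⧸ latE Λ E)) ↔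
        sigmaEStar Λ E Z ∈ UU Λ (F : Set Λ) := by
      intro Z
      rw [aux_UU, aux_UU]
      simp [sigmaEStar]
    exact ⟨F.image (QuotientAddGroup.mk' (latE Λ E)), (key Y).2 hF,
      fun Z hZ => hFW ((key Z).1 hZ)⟩

theorem statement18 [Module.Free ℤ Λ] [Module.Finite ℤ Λ] (E : Set Λ) :
    (LL Λ E = ⋂ l ∈ E \ {(0 : Λ)}, HH Λ l) ∧
    (LL Λ E = {X : PosParts Λ | (latE Λ E : Set Λ) ⊆ X.val}) ∧
    IsClosed (LL Λ E) ∧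
    ({φ : Module.Dual ℝ (RV Λ) |
        (⟨PosSet Λ φ, isPositivePart_posSet Λ φ⟩ : PosParts Λ) ∈ LL Λ E}
      = {φ : Module.Dual ℝ (RV Λ) | ∀ l ∈ E, φ (iota Λ l) = 0}) ∧
    (Set.range (sigmaEStar Λ E) = LL Λ E) ∧
    (∃ h : PosParts (Λ ⧸ latE Λ E) ≃ₜ (LL Λ E : Set (PosParts Λ)),
      ∀ Y : PosParts (Λ ⧸ latE Λ E), (h Y : PosParts Λ) = sigmaEStar Λ E Y) := by
  refine ⟨?_, aux_LL E, aux_closed E, ?_, aux_range E, ?_⟩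
  · ext X
    simp only [Set.mem_iInter]
    constructor
    · intro h l hl a ha
      rw [Set.mem_singleton_iff.1 ha]
      exact h hl.1
    · intro h l hl
      by_cases h0 : l = 0
      · subst h0
        have := aux_zero_s18 X.2
        exact ⟨this, by simpa using this⟩
      · exact h l ⟨hl, h0⟩ rfl
  · ext φ
    constructor
    · intro h l hl
      obtain ⟨h1, h2⟩ := h hl
      have h1' : (0:ℝ) ≤ φ (iota Λ l) := h1
      have h2' : (0:ℝ) ≤ φ (iota Λ (-l)) := h2
      rw [map_neg, map_neg] at h2'
      linarith
    · intro h l hl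
      have h0 : φ (iota Λ l) = 0 := h l hl
      constructor
      · exact h0.ge
      · show (0:ℝ) ≤ φ (iota Λ (-l))
        rw [map_neg, map_neg, h0, neg_zero]
  · exact ⟨(aux_emb E).toHomeomorph.trans (Homeomorph.setCongr (aux_range E)), fun Y => rfl⟩
end
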